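/- arXiv:0809.2716 — 3 statements merged into one kernel-verified Lean document; each statement's English description precedes it below -/
import Mathlib

section
/- (Janssen representation of the Gabor frame operator, weak form.) Let D ⊂ ℝ²ᴺ be a full-rank lattice with adjoint lattice D^! and covolume vol(D), and let f, g, k be Schwartz functions on ℝᴺ. Then ∑_{h ∈ D} ⟨f, π(h)g⟩ · ⟨π(h)g, k⟩ = vol(D)⁻¹ ∑_{h^! ∈ D^!} ⟨g, π(h^!)g⟩ · ⟨π(h^!)f, k⟩, where ⟨·,·⟩ is the L²(ℝᴺ) inner product and both series converge absolutely. In other words, the Gabor frame operator S_{g,D} f = ∑_{h ∈ D} ⟨f, π(h)g⟩ π(h)g coincides weakly with vol(D)⁻¹ ∑_{h^! ∈ D^!} ⟨g, π(h^!)g⟩ π(h^!) f. -/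
open MeasureTheory Complex Real

noncomputable section

abbrev EV (N : ℕ) := Fin N → ℝ

def dotR {N : ℕ} (a b : EV N) : ℝ := ∑ i, a i * b i

/-- Time–frequency shift `π(x,ω)`: `(π(x,ω)f)(t) = e^{2πi t·ω} f(t−x)`. -/
def tfShift {N : ℕ} (x ω : EV N) (f : EV N → ℂ) : EV N → ℂ :=
  fun t => Complex.exp (2 * (π : ℂ) * Complex.I * ((dotR t ω : ℝ) : ℂ)) * f (t - x)

/-- The `L²` inner product `⟨f, g⟩ = ∫ f(t) conj(g(t)) dt`. -/
def innerL2 {N : ℕ} (f g : EV N → ℂ) : ℂ := ∫ t : EV N, f t * (starRingEnd ℂ) (g t)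

/-- The integer points of `ℝ²ᴺ = ℝᴺ × ℝᴺ`. -/
def intPoint {N : ℕ} (m : (Fin N → ℤ) × (Fin N → ℤ)) : EV N × EV N :=
  (fun i => (m.1 i : ℝ), fun i => (m.2 i : ℝ))

/-- The adjoint lattice `D^! = { z : π(z)π(h) = π(h)π(z) for all h ∈ D }`. -/
def adjointLattice {N : ℕ} (D : Set (EV N × EV N)) : Set (EV N × EV N) :=
  {z : EV N × EV N | ∀ h ∈ D, ∀ f : EV N → ℂ,
    tfShift z.1 z.2 (tfShift h.1 h.2 f) = tfShift h.1 h.2 (tfShift z.1 z.2 f)}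

/-- The unitary character `r ↦ e^{2πir}` of `ℝ`. -/
def expi (r : ℝ) : ℂ := Complex.exp (2 * (π : ℂ) * Complex.I * ((r : ℝ) : ℂ))

lemma expi_add (r s : ℝ) : expi (r + s) = expi r * expi s := by
  simp only [expi, ← Complex.exp_add]; congr 1; push_cast; ring

@[simp] lemma expi_zero : expi 0 = 1 := by simp [expi]

@[simp] lemma norm_expi (r : ℝ) : ‖expi r‖ = 1 := by
  rw [expi, show 2 * (π : ℂ) * Complex.I * (r : ℂ) = ((2 * π * r : ℝ) : ℂ) * Complex.I by
    push_cast; ring]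
  exact Complex.norm_exp_ofReal_mul_I _

lemma conj_expi (r : ℝ) : (starRingEnd ℂ) (expi r) = expi (-r) := by
  simp only [expi, ← Complex.exp_conj, map_mul, Complex.conj_ofReal, Complex.conj_I, map_ofNat]
  congr 1; push_cast; ring

@[fun_prop] lemma continuous_expi : Continuous expi := by unfold expi; fun_prop

lemma expi_eq_one_iff (r : ℝ) : expi r = 1 ↔ ∃ n : ℤ, r = n := by
  rw [expi, Complex.exp_eq_one_iff]
  refine exists_congr fun n => ?_
  rw [show 2 * (π : ℂ) * Complex.I * (r : ℂ) = (r : ℂ) * (2 * π * Complex.I) by ring,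
    mul_left_inj' Complex.two_pi_I_ne_zero]
  norm_cast

lemma expi_int (n : ℤ) : expi n = 1 := (expi_eq_one_iff _).2 ⟨n, rfl⟩

/-- `F` is bounded by a multiple of `(1 + ‖z‖)⁻ᴹ`. -/
def PolyDecay {E : Type*} [NormedAddCommGroup E] (M : ℕ) (F : E → ℂ) : Prop :=
  ∃ C, 0 ≤ C ∧ ∀ z, ‖F z‖ ≤ C * ((1 + ‖z‖) ^ M)⁻¹

section PolyDecay

variable {E : Type*} [NormedAddCommGroup E]

lemma PolyDecay.integrable [NormedSpace ℝ E] [FiniteDimensional ℝ E] [MeasurableSpace E]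
    [BorelSpace E] {μ : Measure E} [μ.IsAddHaarMeasure] {M : ℕ}
    (hM : Module.finrank ℝ E < M) {F : E → ℂ} (hF : PolyDecay M F) (hc : Continuous F) :
    Integrable F μ := by
  obtain ⟨C, -, hC⟩ := hF
  have h := (integrable_one_add_norm (E := E) (μ := μ) (r := M) (by exact_mod_cast hM)).const_mul C
  refine h.mono' hc.aestronglyMeasurable (Filter.Eventually.of_forall fun z => ?_)
  simpa [Real.rpow_neg (by positivity : (0 : ℝ) ≤ 1 + ‖z‖)] using hC z

lemma summable_one_add_norm_int {d : Type*} [Fintype d] {M : ℕ} (hM : Fintype.card d < M) :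
    Summable fun m : d → ℤ => ((1 + ‖fun i => (m i : ℝ)‖) ^ M)⁻¹ := by
  classical
  let L := Submodule.span ℤ (Set.range (Pi.basisFun ℝ d))
  have hL : Module.finrank ℤ L = Fintype.card d := by
    rw [ZLattice.rank ℝ L, Module.finrank_fintype_fun_eq_card]
  have h := ZLattice.summable_norm_pow_inv L M (by rw [hL]; exact hM)
  have hmem : ∀ m : d → ℤ, (fun i => (m i : ℝ)) ∈ L := fun m => by
    rw [Module.Basis.mem_span_iff_repr_mem]
    intro i; simp
  have hinj : Function.Injective fun m : d → ℤ => (⟨fun i => (m i : ℝ), hmem m⟩ : L) := by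
    intro a b hab
    funext i
    simpa using congrFun (congrArg Subtype.val hab) i
  refine (h.comp_injective hinj).of_norm_bounded_eventually ?_
  have : ∀ᶠ m : d → ℤ in Filter.cofinite, m ≠ 0 := by simp
  filter_upwards [this] with m hm
  have hpos : 0 < ‖fun i => (m i : ℝ)‖ := by
    rw [norm_pos_iff]
    intro h0
    exact hm (funext fun i => by simpa using congrFun h0 i)
  rw [Real.norm_of_nonneg (by positivity)]
  simp only [Function.comp, inv_pow, Submodule.coe_norm]
  gcongr
  linarith

lemma PolyDecay.comp_antilipschitz {G : Type*} [NormedAddCommGroup G] {M : ℕ} {F : E → ℂ}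
    (hF : PolyDecay M F) (u : G → E) (K : ℝ) (hK : 0 ≤ K) (hu : ∀ x, ‖x‖ ≤ K * ‖u x‖) :
    PolyDecay M fun x => F (u x) := by
  obtain ⟨C, hC0, hC⟩ := hF
  refine ⟨C * (1 + K) ^ M, by positivity, fun x => (hC _).trans ?_⟩
  rw [mul_assoc]
  gcongr
  rw [← div_eq_mul_inv, inv_eq_one_div, div_le_div_iff₀ (by positivity) (by positivity), one_mul,
    ← mul_pow]
  gcongr
  nlinarith [hu x, norm_nonneg (u x)]

lemma PolyDecay.comp_linear {V W : Type*} [NormedAddCommGroup V] [NormedSpace ℝ V]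
    [FiniteDimensional ℝ V] [NormedAddCommGroup W] [NormedSpace ℝ W] {M : ℕ} {F : W → ℂ}
    (hF : PolyDecay M F) (u : V →ₗ[ℝ] W) (hu : Function.Injective u) :
    PolyDecay M fun x => F (u x) := by
  obtain ⟨K, -, hK⟩ := u.exists_antilipschitzWith (LinearMap.ker_eq_bot.2 hu)
  refine hF.comp_antilipschitz u K K.2 fun x => ?_
  simpa using hK.le_mul_norm_sub x 0

lemma PolyDecay.summable_int {d : Type*} [Fintype d] {M : ℕ} (hM : Fintype.card d < M)
    {F : (d → ℝ) → ℂ} (hF : PolyDecay M F) : Summable fun m : d → ℤ => F fun i => (m i : ℝ) := by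
  obtain ⟨C, -, hC⟩ := hF
  exact ((summable_one_add_norm_int hM).mul_left C).of_norm_bounded fun m => hC _

end PolyDecay

section Poisson

variable {d : Type*} [Fintype d]

lemma mFourier_coe (n : d → ℤ) (x : d → ℝ) :
    UnitAddTorus.mFourier n (fun i => (x i : UnitAddCircle)) = expi (∑ i, n i * x i) := by
  simp only [UnitAddTorus.mFourier, ContinuousMap.coe_mk, fourier_coe_apply, expi,
    ← Complex.exp_sum]
  congr 1
  push_cast
  rw [Finset.mul_sum]
  refine Finset.sum_congr rfl fun i _ => ?_
  ring

lemma continuous_tsum_int_translates {M : ℕ} (hM : Fintype.card d < M) {H : (d → ℝ) → ℂ}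
    (hH : PolyDecay M H) (hc : Continuous H) :
    Continuous fun x : d → ℝ => ∑' m : d → ℤ, H (x + fun i => (m i : ℝ)) := by
  obtain ⟨C, hC0, hC⟩ := hH
  rw [continuous_iff_continuousAt]
  intro x₀
  have hs := ((summable_one_add_norm_int hM).mul_left (C * (1 + (‖x₀‖ + 1)) ^ M))
  have : ContinuousOn (fun x : d → ℝ => ∑' m : d → ℤ, H (x + fun i => (m i : ℝ)))
      (Metric.ball x₀ 1) := by
    refine continuousOn_tsum (fun m => by fun_prop) hs fun m x hx => (hC _).trans ?_
    have hx' : ‖x‖ ≤ ‖x₀‖ + 1 := by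
      have := norm_sub_norm_le x x₀
      rw [Metric.mem_ball, dist_eq_norm] at hx
      linarith
    set v : d → ℝ := fun i => (m i : ℝ)
    have hv : ‖v‖ ≤ ‖x + v‖ + ‖x‖ := by
      simpa using norm_sub_le (x + v) x
    rw [mul_assoc]
    gcongr
    rw [← div_eq_mul_inv, inv_eq_one_div, div_le_div_iff₀ (by positivity) (by positivity),
      one_mul, ← mul_pow]
    gcongr
    nlinarith [norm_nonneg (x + v), norm_nonneg x₀]
  exact this.continuousAt (Metric.ball_mem_nhds _ one_pos)

lemma pi_Ioc_translates {d : Type*} (m : d → ℤ) :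
    (fun x : d → ℝ => x + fun i => (m i : ℝ)) ⁻¹'
      {x : d → ℝ | ∀ i, x i ∈ Set.Ioc (m i : ℝ) (m i + 1)} =
    {x : d → ℝ | ∀ i, x i ∈ Set.Ioc ((0 : d → ℝ) i) ((0 : d → ℝ) i + 1)} := by
  ext x
  refine forall_congr' fun i => ?_
  simp only [Pi.add_apply, Set.mem_Ioc, Pi.zero_apply]
  constructor <;> rintro ⟨h1, h2⟩ <;> constructor <;> linarith

lemma hasSum_setIntegral_int_translates {G : Type*} [NormedAddCommGroup G] [NormedSpace ℝ G]
    {H : (d → ℝ) → G} (hi : Integrable H) :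
    HasSum (fun m : d → ℤ =>
      ∫ x in {x : d → ℝ | ∀ i, x i ∈ Set.Ioc ((0 : d → ℝ) i) ((0 : d → ℝ) i + 1)},
        H (x + fun i => (m i : ℝ))) (∫ x, H x) := by
  have hmeas : ∀ m : d → ℤ,
      MeasurableSet {x : d → ℝ | ∀ i, x i ∈ Set.Ioc (m i : ℝ) (m i + 1)} := fun m =>
    MeasurableSet.univ_pi' fun i => measurableSet_Ioc
  have hmem : ∀ (x : ℝ) (n : ℤ), x ∈ Set.Ioc (n : ℝ) (n + 1) ↔ ⌈x⌉ = n + 1 := by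
    intro x n
    rw [Int.ceil_eq_iff]; simp
  have hdisj : Pairwise (Function.onFun Disjoint fun m : d → ℤ =>
      {x : d → ℝ | ∀ i, x i ∈ Set.Ioc (m i : ℝ) (m i + 1)}) := by
    intro m n hmn
    refine Set.disjoint_left.2 fun x hx hx' => hmn (funext fun i => ?_)
    have h1 := (hmem _ _).1 (hx i)
    have h2 := (hmem _ _).1 (hx' i)
    omega
  have huniv : ⋃ m : d → ℤ, {x : d → ℝ | ∀ i, x i ∈ Set.Ioc (m i : ℝ) (m i + 1)} = Set.univ := by
    refine Set.eq_univ_of_forall fun x => Set.mem_iUnion.2 ⟨fun i => ⌈x i⌉ - 1, fun i => ?_⟩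
    rw [hmem]; ring
  have h := hasSum_integral_iUnion hmeas hdisj (f := H) (μ := volume) hi.integrableOn
  rw [huniv, setIntegral_univ] at h
  convert! h using 2 with m
  rw [← pi_Ioc_translates m]
  exact (measurePreserving_add_right volume (fun i => (m i : ℝ))).setIntegral_preimage_emb
    (measurableEmbedding_addRight _) H _

/-- **Poisson summation** over `ℤᵈ`. -/
lemma poisson_summation {M : ℕ} (hM : Fintype.card d < M) {H : (d → ℝ) → ℂ}
    (hH : PolyDecay M H) (hc : Continuous H)
    (hs : Summable fun n : d → ℤ => ∫ x, expi (-∑ i, (n i : ℝ) * x i) * H x) :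
    ∑' m : d → ℤ, H (fun i => (m i : ℝ)) =
      ∑' n : d → ℤ, ∫ x, expi (-∑ i, (n i : ℝ) * x i) * H x := by
  have hHi : Integrable H := hH.integrable (by simpa using hM) hc
  set P : (d → ℝ) → ℂ := fun x => ∑' m : d → ℤ, H (x + fun i => (m i : ℝ)) with hP
  have hPc : Continuous P := continuous_tsum_int_translates hM hH hc
  have hPper : ∀ (x : d → ℝ) (k : d → ℤ), P (x + fun i => (k i : ℝ)) = P x := by
    intro x k
    simp only [hP]
    rw [← (Equiv.addLeft k).tsum_eq fun m : d → ℤ => H (x + fun i => (m i : ℝ))]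
    refine tsum_congr fun m => congrArg H ?_
    ext i
    simp [add_assoc]
  have hq : IsOpenQuotientMap fun (x : d → ℝ) (i : d) => (x i : UnitAddCircle) :=
    IsOpenQuotientMap.piMap fun _ => QuotientAddGroup.isOpenQuotientMap_mk
  have hcompat : ∀ x y : d → ℝ, (fun i => (x i : UnitAddCircle)) =
      (fun i => (y i : UnitAddCircle)) →
      P x = P y := by
    intro x y hxy
    have : ∀ i, ∃ k : ℤ, y i = x i + k := fun i => by
      have h : ((y i - x i : ℝ) : UnitAddCircle) = 0 := by
        rw [AddCircle.coe_sub, sub_eq_zero]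
        exact (congrFun hxy i).symm
      obtain ⟨k, hk⟩ := (AddCircle.coe_eq_zero_iff 1).1 h
      exact ⟨k, by simp only [zsmul_eq_mul, mul_one] at hk; linarith⟩
    choose k hk using this
    rw [← hPper x k]
    exact congrArg P (funext fun i => (hk i).symm)
  let q : C(d → ℝ, UnitAddTorus d) := ⟨_, hq.continuous⟩
  have hlift : Function.FactorsThrough (⟨P, hPc⟩ : C(d → ℝ, ℂ)) q := fun x y h => hcompat x y h
  let f : C(UnitAddTorus d, ℂ) :=
    Topology.IsQuotientMap.lift (f := q) hq.isQuotientMap ⟨P, hPc⟩ hlift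
  have hf : ∀ x : d → ℝ, f (fun i => (x i : UnitAddCircle)) = P x := fun x =>
    DFunLike.congr_fun (Topology.IsQuotientMap.lift_comp (f := q) hq.isQuotientMap ⟨P, hPc⟩ hlift) x
  have hcoeff : ∀ n, UnitAddTorus.mFourierCoeff f n = ∫ x, expi (-∑ i, (n i : ℝ) * x i) * H x := by
    intro n
    have hint : Integrable fun x : d → ℝ => expi (-∑ i, (n i : ℝ) * x i) * H x :=
      hHi.bdd_mul (Continuous.aestronglyMeasurable (by fun_prop))
        (Filter.Eventually.of_forall fun x => (norm_expi _).le)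
    have h1 := hasSum_setIntegral_int_translates hint
    have h2 := hasSum_setIntegral_int_translates hint.norm
    rw [UnitAddTorus.mFourierCoeff_eq_integral _ _ 0, ← h1.tsum_eq,
      integral_tsum_of_summable_integral_norm _ h2.summable]
    · refine integral_congr_ae (Filter.Eventually.of_forall fun x => ?_)
      simp only [hf, mFourier_coe, smul_eq_mul, hP]
      rw [← tsum_mul_left]
      refine tsum_congr fun m => ?_
      congr 1
      have : (-∑ i, (n i : ℝ) * (x + fun i => (m i : ℝ)) i) =
          ∑ i, (((-n) i : ℤ) : ℝ) * x i + ((-∑ i, n i * m i : ℤ) : ℝ) := by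
        push_cast
        simp only [Pi.add_apply, mul_add, Finset.sum_add_distrib, Pi.neg_apply, Int.cast_neg,
          neg_mul, Finset.sum_neg_distrib]
        ring
      rw [this, expi_add, expi_int, mul_one]
    · intro m
      exact (hint.comp_add_right _).integrableOn
  have hsum := UnitAddTorus.hasSum_mFourier_series_apply_of_summable (f := f)
    (by rw [funext hcoeff]; exact hs) (fun i => ((0 : ℝ) : UnitAddCircle))
  have h0 := hf 0
  simp only [Pi.zero_apply] at h0
  rw [h0] at hsum
  simp only [hcoeff, hP, zero_add] at hsum
  rw [← hsum.tsum_eq]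
  refine tsum_congr fun n => ?_
  rw [mFourier_coe]; simp

end Poisson

section ShortTimeFourier

variable {N : ℕ}

lemma dotR_comm (a b : EV N) : dotR a b = dotR b a := by
  simp only [dotR, mul_comm]

lemma dotR_sub_left (a b c : EV N) : dotR (a - b) c = dotR a c - dotR b c := by
  simp [dotR, sub_mul, Finset.sum_sub_distrib]

lemma dotR_sub_right (a b c : EV N) : dotR a (b - c) = dotR a b - dotR a c := by
  simp [dotR, mul_sub, Finset.sum_sub_distrib]

lemma dotR_neg_right (a b : EV N) : dotR a (-b) = -dotR a b := by
  simp [dotR]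

@[fun_prop] lemma Continuous.dotR {X : Type*} [TopologicalSpace X] {u v : X → EV N}
    (hu : Continuous u) (hv : Continuous v) : Continuous fun x => dotR (u x) (v x) := by
  unfold _root_.dotR; fun_prop

lemma SchwartzMap.polyDecay {E : Type*} [NormedAddCommGroup E] [NormedSpace ℝ E]
    (f : SchwartzMap E ℂ) (M : ℕ) : PolyDecay M f := by
  refine ⟨2 ^ M * ((Finset.Iic (M, 0)).sup fun m => SchwartzMap.seminorm ℝ m.1 m.2) f,
    by positivity, fun z => ?_⟩
  have h := SchwartzMap.one_add_le_sup_seminorm_apply (𝕜 := ℝ) (m := (M, 0)) (k := M) (n := 0)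
    le_rfl le_rfl f z
  rw [norm_iteratedFDeriv_zero] at h
  rw [← div_eq_mul_inv, le_div_iff₀ (by positivity), mul_comm]
  exact h

lemma SchwartzMap.exists_fourier (f : SchwartzMap (EV N) ℂ) :
    ∃ φ : SchwartzMap (EV N) ℂ, (∀ ξ, φ ξ = ∫ t, expi (-dotR t ξ) * f t) ∧
      ∀ t, f t = ∫ ξ, expi (dotR t ξ) * φ ξ := by
  let e : EuclideanSpace ℝ (Fin N) ≃L[ℝ] EV N := EuclideanSpace.equiv (Fin N) ℝ
  let F : SchwartzMap (EuclideanSpace ℝ (Fin N)) ℂ :=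
    SchwartzMap.compCLMOfContinuousLinearEquiv ℂ e f
  have hinner : ∀ a b : EV N, inner ℝ (e.symm a) (e.symm b) = dotR b a := by
    intro a b
    simp [PiLp.inner_apply, dotR, e]
  have hint : ∀ G : EuclideanSpace ℝ (Fin N) → ℂ, ∫ v, G v = ∫ t, G (e.symm t) := fun G =>
    ((PiLp.volume_preserving_toLp (Fin N)).integral_comp
      (MeasurableEquiv.toLp 2 _).measurableEmbedding G).symm
  refine ⟨SchwartzMap.compCLMOfContinuousLinearEquiv ℂ e.symm (FourierTransform.fourier F),
    fun ξ => ?_, fun t => ?_⟩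
  · simp only [SchwartzMap.compCLMOfContinuousLinearEquiv_apply, Function.comp,
      SchwartzMap.fourier_coe, Real.fourier_eq']
    rw [hint]
    refine integral_congr_ae (Filter.Eventually.of_forall fun t => ?_)
    simp only [hinner, smul_eq_mul, expi, F, SchwartzMap.compCLMOfContinuousLinearEquiv_apply,
      Function.comp, ContinuousLinearEquiv.apply_symm_apply, dotR_comm ξ t]
    congr 2; push_cast; ring
  · have h : F (e.symm t) =
        (FourierTransformInv.fourierInv (FourierTransform.fourier F)) (e.symm t) := by
      rw [FourierTransform.fourierInv_fourier_eq]
    have h' : F (e.symm t) = f t := by simp [F]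
    rw [← h', h, SchwartzMap.fourierInv_coe, Real.fourierInv_eq', hint]
    refine integral_congr_ae (Filter.Eventually.of_forall fun ξ => ?_)
    simp only [hinner, smul_eq_mul, expi, SchwartzMap.compCLMOfContinuousLinearEquiv_apply,
      Function.comp]
    congr 2; push_cast; ring

lemma SchwartzMap.exists_conj (f : SchwartzMap (EV N) ℂ) :
    ∃ u : SchwartzMap (EV N) ℂ, ∀ t, u t = (starRingEnd ℂ) (f t) :=
  ⟨SchwartzMap.postcompCLM (𝕜 := ℝ) (Complex.conjCLE : ℂ →L[ℝ] ℂ) f, fun t => by simp⟩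

lemma SchwartzMap.exists_mul_conj_translate (f g : SchwartzMap (EV N) ℂ) (x : EV N) :
    ∃ u : SchwartzMap (EV N) ℂ, ∀ t, u t = f t * (starRingEnd ℂ) (g (t - x)) := by
  obtain ⟨h, hh⟩ := (g.compSubConstCLM ℂ x).exists_conj
  exact ⟨SchwartzMap.pairing (ContinuousLinearMap.mul ℂ ℂ) f h, fun t => by
    simp [SchwartzMap.pairing_apply_apply, hh]⟩

lemma innerL2_tfShift (f g : EV N → ℂ) (x ω : EV N) :
    innerL2 f (tfShift x ω g) = ∫ t, expi (-dotR t ω) * (f t * (starRingEnd ℂ) (g (t - x))) := by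
  refine integral_congr_ae (Filter.Eventually.of_forall fun t => ?_)
  simp only [tfShift, map_mul]
  rw [← expi, conj_expi]
  ring

lemma innerL2_conj (f g : EV N → ℂ) : (starRingEnd ℂ) (innerL2 f g) = innerL2 g f := by
  simp only [innerL2, ← integral_conj, map_mul, Complex.conj_conj, mul_comm]

lemma integral_mul_translate_le {M : ℕ} {a b : EV N → ℂ} (ha : PolyDecay (M + (N + 1)) a)
    (hb : PolyDecay M b) :
    ∃ C, 0 ≤ C ∧ ∀ x, ∫ t, ‖a t‖ * ‖b (t - x)‖ ≤ C * ((1 + ‖x‖) ^ M)⁻¹ := by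
  obtain ⟨Ca, ha0, ha⟩ := ha
  obtain ⟨Cb, hb0, hb⟩ := hb
  have hI : Integrable fun t : EV N => ((1 + ‖t‖) ^ (N + 1))⁻¹ := by
    have := integrable_one_add_norm (E := EV N) (μ := volume) (r := (N + 1 : ℕ)) (by simp)
    refine this.congr (Filter.Eventually.of_forall fun t => ?_)
    simp only [Real.rpow_neg (by positivity : (0 : ℝ) ≤ 1 + ‖t‖), Real.rpow_natCast]
  refine ⟨Ca * Cb * ∫ t : EV N, ((1 + ‖t‖) ^ (N + 1))⁻¹, by positivity, fun x => ?_⟩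
  rw [mul_right_comm, ← integral_const_mul]
  refine integral_mono_of_nonneg (Filter.Eventually.of_forall fun t => by positivity)
    (hI.const_mul _) (Filter.Eventually.of_forall fun t => ?_)
  have hx : 1 + ‖x‖ ≤ (1 + ‖t‖) * (1 + ‖t - x‖) := by
    have : ‖x‖ ≤ ‖t‖ + ‖t - x‖ := by simpa using norm_sub_le t (t - x)
    nlinarith [mul_nonneg (norm_nonneg t) (norm_nonneg (t - x))]
  calc ‖a t‖ * ‖b (t - x)‖
      ≤ (Ca * ((1 + ‖t‖) ^ (M + (N + 1)))⁻¹) * (Cb * ((1 + ‖t - x‖) ^ M)⁻¹) := by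
        gcongr
        · exact ha t
        · exact hb _
    _ = Ca * Cb * (((1 + ‖t‖) * (1 + ‖t - x‖)) ^ M)⁻¹ * ((1 + ‖t‖) ^ (N + 1))⁻¹ := by
        rw [pow_add, mul_pow, mul_inv, mul_inv]; ring
    _ ≤ Ca * Cb * ((1 + ‖x‖) ^ M)⁻¹ * ((1 + ‖t‖) ^ (N + 1))⁻¹ := by gcongr

lemma integrable_expi_mul {E : Type*} [MeasurableSpace E] [TopologicalSpace E] [BorelSpace E]
    [SecondCountableTopology E] {μ : Measure E} {F : E → ℂ} (hF : Integrable F μ) {r : E → ℝ}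
    (hr : Continuous r) : Integrable (fun z => expi (r z) * F z) μ :=
  hF.bdd_mul (Continuous.aestronglyMeasurable (by fun_prop))
    (Filter.Eventually.of_forall fun x => (norm_expi _).le)

lemma innerL2_tfShift_eq_integral_fourier (f φ g ψ : SchwartzMap (EV N) ℂ)
    (hφ : ∀ t, f t = ∫ ξ, expi (dotR t ξ) * φ ξ)
    (hψ : ∀ ξ, ψ ξ = ∫ t, expi (-dotR t ξ) * (starRingEnd ℂ) (g t)) (x ω : EV N) :
    innerL2 f (tfShift x ω g) = ∫ ξ, φ ξ * (expi (-dotR x (ω - ξ)) * ψ (ω - ξ)) := by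
  obtain ⟨g', hg'⟩ := (g.compSubConstCLM ℂ x).exists_conj
  have hg : ∀ t, g' t = (starRingEnd ℂ) (g (t - x)) := fun t => by simp [hg']
  have hint : Integrable (fun p : EV N × EV N =>
      expi (-dotR p.1 (ω - p.2)) * (g' p.1 * φ p.2)) (volume.prod volume) :=
    integrable_expi_mul (g'.integrable.mul_prod φ.integrable) (by fun_prop)
  calc innerL2 f (tfShift x ω g)
      = ∫ t, ∫ ξ, expi (-dotR t (ω - ξ)) * (g' t * φ ξ) := by
        rw [innerL2_tfShift]
        refine integral_congr_ae (Filter.Eventually.of_forall fun t => ?_)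
        simp only
        rw [← hg, hφ, ← integral_mul_const, ← integral_const_mul]
        refine integral_congr_ae (Filter.Eventually.of_forall fun ξ => ?_)
        simp only
        rw [dotR_sub_right, neg_sub, sub_eq_add_neg, expi_add]
        ring
    _ = ∫ ξ, ∫ t, expi (-dotR t (ω - ξ)) * (g' t * φ ξ) := integral_integral_swap hint
    _ = _ := by
        refine integral_congr_ae (Filter.Eventually.of_forall fun ξ => ?_)
        simp only
        rw [hψ, ← integral_sub_right_eq_self
          (fun t => expi (-dotR t (ω - ξ)) * (starRingEnd ℂ) (g t)) x, ← integral_const_mul,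
          ← integral_const_mul]
        refine integral_congr_ae (Filter.Eventually.of_forall fun t => ?_)
        simp only
        rw [hg, dotR_sub_left, neg_sub, sub_eq_add_neg (dotR x _), expi_add,
          show ∀ a b c d e : ℂ, d * (a * (b * c * e)) = (a * b) * (c * (e * d)) by intros; ring,
          ← expi_add, neg_add_cancel, expi_zero, one_mul]

lemma polyDecay_innerL2_tfShift (f g : SchwartzMap (EV N) ℂ) (M : ℕ) :
    PolyDecay M fun z : EV N × EV N => innerL2 f (tfShift z.1 z.2 g) := by
  obtain ⟨φ, -, hφ⟩ := f.exists_fourier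
  obtain ⟨g', hg'⟩ := g.exists_conj
  obtain ⟨ψ, hψ, -⟩ := g'.exists_fourier
  obtain ⟨C₁, hC₁0, hC₁⟩ := integral_mul_translate_le (f.polyDecay (M + (N + 1))) (g.polyDecay M)
  obtain ⟨C₂, hC₂0, hC₂⟩ := integral_mul_translate_le (φ.polyDecay (M + (N + 1)))
    ((ψ.polyDecay M).comp_antilipschitz (fun u => -u) 1 zero_le_one (by simp))
  refine ⟨max C₁ C₂, by positivity, fun z => ?_⟩
  have h₁ : ‖innerL2 f (tfShift z.1 z.2 g)‖ ≤ C₁ * ((1 + ‖z.1‖) ^ M)⁻¹ := by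
    refine le_trans ?_ (hC₁ z.1)
    rw [innerL2_tfShift]
    refine (norm_integral_le_integral_norm _).trans_eq ?_
    simp
  have h₂ : ‖innerL2 f (tfShift z.1 z.2 g)‖ ≤ C₂ * ((1 + ‖z.2‖) ^ M)⁻¹ := by
    refine le_trans ?_ (hC₂ z.2)
    rw [innerL2_tfShift_eq_integral_fourier f φ g ψ hφ (by simpa only [hg'] using hψ)]
    refine (norm_integral_le_integral_norm _).trans_eq ?_
    simp
  rcases max_choice ‖z.1‖ ‖z.2‖ with h | h <;> rw [Prod.norm_def, h]
  · exact h₁.trans (by gcongr; exact le_max_left _ _)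
  · exact h₂.trans (by gcongr; exact le_max_right _ _)

lemma continuous_innerL2_tfShift (f g : SchwartzMap (EV N) ℂ) :
    Continuous fun z : EV N × EV N => innerL2 f (tfShift z.1 z.2 g) := by
  obtain ⟨C, hC0, hC⟩ := g.polyDecay 0
  simp only [innerL2_tfShift]
  refine continuous_of_dominated (bound := fun t => ‖f t‖ * C) (fun z => ?_) (fun z => ?_)
    (f.integrable.norm.mul_const C) ?_
  · exact Continuous.aestronglyMeasurable (by fun_prop)
  · refine Filter.Eventually.of_forall fun t => ?_
    simp only [norm_mul, norm_expi, one_mul, RCLike.norm_conj]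
    gcongr
    simpa using hC (t - z.1)
  · exact Filter.Eventually.of_forall fun t => by fun_prop

end ShortTimeFourier

section Product

variable {N : ℕ}

instance : (volume : Measure (EV N × EV N)).IsAddHaarMeasure :=
  Measure.prod.instIsAddHaarMeasure (volume : Measure (EV N)) (volume : Measure (EV N))

lemma PolyDecay.mul {E : Type*} [NormedAddCommGroup E] {M : ℕ} {F G : E → ℂ}
    (hF : PolyDecay M F) (hG : PolyDecay 0 G) : PolyDecay M fun z => F z * G z := by
  obtain ⟨C₁, hC₁0, hC₁⟩ := hF
  obtain ⟨C₂, hC₂0, hC₂⟩ := hG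
  refine ⟨C₁ * C₂, by positivity, fun z => ?_⟩
  have h₂ : ‖G z‖ ≤ C₂ := by simpa using hC₂ z
  rw [norm_mul, mul_right_comm]
  exact mul_le_mul (hC₁ z) h₂ (norm_nonneg _) (by positivity)

lemma polyDecay_innerL2_mul (f g h k : SchwartzMap (EV N) ℂ) (M : ℕ) :
    PolyDecay M fun z : EV N × EV N =>
      innerL2 f (tfShift z.1 z.2 g) * innerL2 (tfShift z.1 z.2 h) k := by
  refine (polyDecay_innerL2_tfShift f g M).mul ?_
  obtain ⟨C, hC0, hC⟩ := polyDecay_innerL2_tfShift k h 0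
  refine ⟨C, hC0, fun z => ?_⟩
  simp only at hC ⊢
  rw [← innerL2_conj, RCLike.norm_conj]
  exact hC z

lemma continuous_innerL2_mul (f g h k : SchwartzMap (EV N) ℂ) :
    Continuous fun z : EV N × EV N =>
      innerL2 f (tfShift z.1 z.2 g) * innerL2 (tfShift z.1 z.2 h) k := by
  simp only [← innerL2_conj (k : EV N → ℂ)]
  exact (continuous_innerL2_tfShift f g).mul
    (Complex.continuous_conj.comp (continuous_innerL2_tfShift k h))

lemma integral_fourier_mul_conj_fourier (u v : SchwartzMap (EV N) ℂ) (y : EV N) :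
    ∫ ω, expi (-dotR ω y) * ((∫ t, expi (-dotR t ω) * u t) *
      (starRingEnd ℂ) (∫ t, expi (-dotR t ω) * v t)) =
    ∫ t, u (t - y) * (starRingEnd ℂ) (v t) := by
  obtain ⟨φ, hφ, hu⟩ := u.exists_fourier
  obtain ⟨w, hw⟩ := v.exists_conj
  have hint : Integrable (fun p : EV N × EV N =>
      expi (dotR (p.2 - y) p.1) * (φ p.1 * w p.2)) (volume.prod volume) :=
    integrable_expi_mul (φ.integrable.mul_prod w.integrable) (by fun_prop)
  calc _ = ∫ ω, ∫ t, expi (dotR (t - y) ω) * (φ ω * w t) := by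
        refine integral_congr_ae (Filter.Eventually.of_forall fun ω => ?_)
        simp only
        rw [← hφ, ← integral_conj, ← integral_const_mul, ← integral_const_mul]
        refine integral_congr_ae (Filter.Eventually.of_forall fun t => ?_)
        simp only [map_mul, conj_expi, neg_neg]
        rw [dotR_sub_left, sub_eq_add_neg, expi_add, hw, dotR_comm y ω]
        ring
    _ = ∫ t, ∫ ω, expi (dotR (t - y) ω) * (φ ω * w t) := integral_integral_swap hint
    _ = _ := by
        refine integral_congr_ae (Filter.Eventually.of_forall fun t => ?_)
        simp only
        rw [hu, ← hw, ← integral_mul_const]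
        simp only [mul_assoc]

lemma integral_integral_expi_mul_translate (a b : SchwartzMap (EV N) ℂ) (η : EV N) :
    ∫ x, ∫ t, expi (-dotR x η) * (a t * b (t - x)) =
      (∫ s, expi (dotR s η) * b s) * ∫ t, expi (-dotR t η) * a t := by
  have hint : Integrable (fun p : EV N × EV N =>
      expi (-dotR p.1 η) * (a p.2 * b (p.2 - p.1))) (volume.prod volume) := by
    refine integrable_expi_mul ?_ (by fun_prop)
    simpa using a.integrable.convolution_integrand (ContinuousLinearMap.mul ℝ ℂ)
      b.integrable.comp_neg (μ := volume) (ν := volume)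
  rw [integral_integral_swap hint, ← integral_const_mul]
  refine integral_congr_ae (Filter.Eventually.of_forall fun t => ?_)
  simp only
  rw [← integral_sub_left_eq_self _ _ t, ← integral_mul_const]
  refine integral_congr_ae (Filter.Eventually.of_forall fun s => ?_)
  simp only [sub_sub_cancel]
  rw [dotR_sub_left, neg_sub, sub_eq_add_neg, expi_add]
  ring

lemma integral_expi_mul_innerL2_mul (f g k : SchwartzMap (EV N) ℂ) (y η : EV N) :
    ∫ z : EV N × EV N, expi (-(dotR z.1 η + dotR z.2 y)) *
      (innerL2 f (tfShift z.1 z.2 g) * innerL2 (tfShift z.1 z.2 g) k) =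
    innerL2 g (tfShift y (-η) g) * innerL2 (tfShift y (-η) f) k := by
  obtain ⟨b, hb⟩ := g.exists_mul_conj_translate g y
  obtain ⟨f', hf'⟩ := k.exists_mul_conj_translate f y
  obtain ⟨a, ha⟩ := f'.exists_conj
  have hint : Integrable (fun z : EV N × EV N => expi (-(dotR z.1 η + dotR z.2 y)) *
      (innerL2 f (tfShift z.1 z.2 g) * innerL2 (tfShift z.1 z.2 g) k)) volume :=
    integrable_expi_mul ((polyDecay_innerL2_mul f g g k _).integrable (Nat.lt_succ_self _)
      (continuous_innerL2_mul f g g k)) (by fun_prop)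
  have hR : innerL2 g (tfShift y (-η) g) = ∫ s, expi (dotR s η) * b s := by
    simp only [innerL2_tfShift, dotR_neg_right, neg_neg, hb]
  have hL : innerL2 (tfShift y (-η) f) k = ∫ t, expi (-dotR t η) * a t := by
    rw [← innerL2_conj, innerL2_tfShift, ← integral_conj]
    simp only [map_mul, conj_expi, dotR_neg_right, neg_neg, ha, hf']
  rw [hR, hL, ← integral_integral_expi_mul_translate, Measure.volume_eq_prod, integral_prod _ hint]
  refine integral_congr_ae (Filter.Eventually.of_forall fun x => ?_)
  obtain ⟨u, hu⟩ := f.exists_mul_conj_translate g x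
  obtain ⟨v, hv⟩ := k.exists_mul_conj_translate g x
  have h := integral_fourier_mul_conj_fourier u v y
  simp only at h ⊢
  rw [integral_const_mul]
  calc _ = ∫ ω, expi (-dotR x η) * (expi (-dotR ω y) * ((∫ t, expi (-dotR t ω) * u t) *
      (starRingEnd ℂ) (∫ t, expi (-dotR t ω) * v t))) := by
        refine integral_congr_ae (Filter.Eventually.of_forall fun ω => ?_)
        simp only
        rw [neg_add, expi_add, ← innerL2_conj (k : EV N → ℂ), innerL2_tfShift, innerL2_tfShift]
        simp only [hu, hv, mul_assoc]
    _ = _ := by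
        rw [integral_const_mul, h]
        congr 1
        refine integral_congr_ae (Filter.Eventually.of_forall fun t => ?_)
        simp only [hu, hv, ha, hf', hb, map_mul, Complex.conj_conj, sub_right_comm t x y]
        ring

end Product

section Lattice

lemma summable_subtype_range_iff {ι X : Type*} {w : ι → X} (hw : Function.Injective w)
    {S : Set X} (hS : S = Set.range w) (F : X → ℂ) :
    (Summable fun z : S => F z) ↔ Summable fun i => F (w i) := by
  subst hS
  exact (Equiv.ofInjective w hw).summable_iff.symm

lemma tsum_subtype_range {ι X : Type*} {w : ι → X} (hw : Function.Injective w)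
    {S : Set X} (hS : S = Set.range w) (F : X → ℂ) :
    ∑' z : S, F z = ∑' i, F (w i) := by
  subst hS
  exact ((Equiv.ofInjective w hw).tsum_eq fun z : Set.range w => F z).symm

lemma injective_intCast_comp {d : Type*} :
    Function.Injective fun (n : d → ℤ) (i : d) => (n i : ℝ) := fun a b hab =>
  funext fun i => by simpa using congrFun hab i

variable {N : ℕ}

lemma tfShift_apply (x ω : EV N) (f : EV N → ℂ) (t : EV N) :
    tfShift x ω f t = expi (dotR t ω) * f (t - x) := rfl

/-- The symplectic form `h.2 · z.1 - h.1 · z.2` on the time–frequency plane. -/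
def sympForm (h z : EV N × EV N) : ℝ := dotR h.2 z.1 - dotR h.1 z.2

lemma mem_adjointLattice_iff {D : Set (EV N × EV N)} {z : EV N × EV N} :
    z ∈ adjointLattice D ↔ ∀ h ∈ D, ∃ n : ℤ, sympForm h z = n := by
  refine forall₂_congr fun h _ => ?_
  have key : ∀ t, expi (dotR t z.2) * expi (dotR (t - z.1) h.2) * expi (sympForm h z) =
      expi (dotR t h.2) * expi (dotR (t - h.1) z.2) := fun t => by
    simp only [← expi_add, sympForm, dotR_sub_left, dotR_comm h.2 z.1]
    congr 1
    ring
  rw [← expi_eq_one_iff]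
  constructor
  · intro H
    have h0 := congrFun (H fun _ => 1) 0
    simp only [tfShift_apply, mul_one] at h0
    rw [← key] at h0
    refine (mul_left_cancel₀ ?_ ((mul_one _).trans h0)).symm
    rw [← norm_ne_zero_iff]
    simp
  · intro H f
    funext t
    have ht := key t
    rw [H, mul_one] at ht
    simp only [tfShift_apply]
    rw [← mul_assoc, ← mul_assoc, ht, sub_right_comm]

variable {d : Type*} [Fintype d]

lemma linearMap_apply_eq_dotR (L : EV N × EV N →ₗ[ℝ] ℝ) (z : EV N × EV N) :
    L z = dotR z.1 (fun i => L (Pi.single i 1, 0)) + dotR z.2 (fun i => L (0, Pi.single i 1)) := by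
  have h₁ := (L ∘ₗ LinearMap.inl ℝ (EV N) (EV N)).pi_apply_eq_sum_univ z.1
  have h₂ := (L ∘ₗ LinearMap.inr ℝ (EV N) (EV N)).pi_apply_eq_sum_univ z.2
  have hz : z = (z.1, 0) + (0, z.2) := by simp
  have hs : ∀ i : Fin N, (Pi.single i 1 : EV N) = fun j => if i = j then 1 else 0 := fun i => by
    funext j
    simp [Pi.single_apply, eq_comm]
  simp only [LinearMap.comp_apply, LinearMap.inl_apply, LinearMap.inr_apply, smul_eq_mul,
    ← hs] at h₁ h₂
  conv_lhs => rw [hz, map_add, h₁, h₂]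
  rfl

/-- For a parametrization `B` of the time–frequency plane, the linear map sending `v` to the
vector that represents `B s ↦ ∑ j, v j * s j` through the symplectic form. -/
def sympDual (B : (d → ℝ) ≃ₗ[ℝ] EV N × EV N) : (d → ℝ) →ₗ[ℝ] EV N × EV N where
  toFun v := (fun i => ∑ j, v j * B.symm (0, Pi.single i 1) j,
    -fun i => ∑ j, v j * B.symm (Pi.single i 1, 0) j)
  map_add' u v := by
    ext i <;> simp [add_mul, Finset.sum_add_distrib, add_comm]
  map_smul' c v := by
    ext i <;> simp [mul_assoc, Finset.mul_sum]

lemma sympForm_sympDual (B : (d → ℝ) ≃ₗ[ℝ] EV N × EV N) (s v : d → ℝ) :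
    sympForm (B s) (sympDual B v) = ∑ j, v j * s j := by
  have h := linearMap_apply_eq_dotR
    (∑ j, v j • (LinearMap.proj j ∘ₗ (B.symm : EV N × EV N →ₗ[ℝ] d → ℝ))) (B s)
  simp only [LinearMap.sum_apply, LinearMap.smul_apply, LinearMap.comp_apply,
    LinearEquiv.coe_coe, LinearEquiv.symm_apply_apply, LinearMap.proj_apply, smul_eq_mul] at h
  rw [h, sympForm, sympDual, LinearMap.coe_mk, AddHom.coe_mk, dotR_neg_right, sub_neg_eq_add,
    add_comm]

lemma sympForm_sympDual_single [DecidableEq d] (B : (d → ℝ) ≃ₗ[ℝ] EV N × EV N) (v : d → ℝ)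
    (j : d) : sympForm (B (Pi.single j 1)) (sympDual B v) = v j := by
  rw [sympForm_sympDual]
  simp [Pi.single_apply]

lemma sympDual_injective (B : (d → ℝ) ≃ₗ[ℝ] EV N × EV N) : Function.Injective (sympDual B) := by
  classical
  intro u v huv
  funext j
  rw [← sympForm_sympDual_single B u, huv, sympForm_sympDual_single]

lemma adjointLattice_range (B : (d → ℝ) ≃ₗ[ℝ] EV N × EV N) :
    adjointLattice (Set.range fun m : d → ℤ => B fun i => (m i : ℝ)) =
      Set.range fun n : d → ℤ => sympDual B fun i => (n i : ℝ) := by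
  classical
  ext z
  simp only [mem_adjointLattice_iff, Set.mem_range]
  constructor
  · intro hz
    obtain ⟨v, rfl⟩ := (LinearMap.injective_iff_surjective_of_finrank_eq_finrank
      B.finrank_eq).1 (sympDual_injective B) z
    have hv : ∀ j, ∃ n : ℤ, v j = n := fun j => by
      obtain ⟨n, hn⟩ := hz _ ⟨Pi.single j 1, rfl⟩
      refine ⟨n, ?_⟩
      rw [← hn, ← sympForm_sympDual_single B v]
      congr 2
      funext i
      simp [Pi.single_apply]
    choose n hn using hv
    exact ⟨n, by simp only [← hn]⟩
  · rintro ⟨n, rfl⟩ _ ⟨m, rfl⟩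
    exact ⟨∑ j, n j * m j, by rw [sympForm_sympDual]; push_cast; rfl⟩

/-- A linear parametrization of `ℝᴺ × ℝᴺ`, read on the coordinate space `ℝ²ᴺ`. -/
def sumParam (A : (EV N × EV N) ≃ₗ[ℝ] (EV N × EV N)) : (Fin N ⊕ Fin N → ℝ) ≃ₗ[ℝ] EV N × EV N :=
  (LinearEquiv.sumArrowLequivProdArrow (Fin N) (Fin N) ℝ ℝ).trans A

lemma range_intPoint (A : (EV N × EV N) ≃ₗ[ℝ] (EV N × EV N)) :
    Set.range (fun m : (Fin N → ℤ) × (Fin N → ℤ) => A (intPoint m)) =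
      Set.range fun m : Fin N ⊕ Fin N → ℤ => sumParam A fun i => (m i : ℝ) :=
  ((Equiv.sumArrowEquivProdArrow (Fin N) (Fin N) ℤ).surjective.range_comp
    fun m => A (intPoint m)).symm

lemma integral_comp_sumParam (A : (EV N × EV N) ≃ₗ[ℝ] (EV N × EV N)) (Φ : EV N × EV N → ℂ) :
    ∫ s, Φ (sumParam A s) =
      (((|LinearMap.det (A : (EV N × EV N) →ₗ[ℝ] (EV N × EV N))|)⁻¹ : ℝ) : ℂ) * ∫ z, Φ z := by
  have h₁ : ∫ s, Φ (sumParam A s) = ∫ z, Φ (A z) :=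
    (volume_measurePreserving_sumPiEquivProdPi fun _ : Fin N ⊕ Fin N => ℝ).integral_comp'
      fun z => Φ (A z)
  have h₂ := integral_map_equiv (μ := (volume : Measure (EV N × EV N)))
    A.toContinuousLinearEquiv.toHomeomorph.toMeasurableEquiv Φ
  have h₃ := Measure.map_linearMap_addHaar_eq_smul_addHaar (volume : Measure (EV N × EV N))
    A.isUnit_det'.ne_zero
  have h₄ : Measure.map A.toContinuousLinearEquiv.toHomeomorph.toMeasurableEquiv
      (volume : Measure (EV N × EV N)) = _ := h₃
  rw [h₁, ← Complex.real_smul, ← abs_inv]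
  refine h₂.symm.trans ?_
  rw [h₄, integral_smul_measure, ENNReal.toReal_ofReal (abs_nonneg _)]

end Lattice

/-- Janssen representation of the Gabor frame operator, weak form: for a full-rank
lattice `D = Aℤ²ᴺ` with adjoint `D^!` and covolume `vol(D) = |det A|`, and Schwartz
`f, g, k` on `ℝᴺ`,
`∑_{h∈D} ⟨f, π(h)g⟩⟨π(h)g, k⟩ = vol(D)⁻¹ ∑_{h^!∈D^!} ⟨g, π(h^!)g⟩⟨π(h^!)f, k⟩`,
both series converging absolutely. -/
theorem janssen_representation_weak {N : ℕ}
    (A : (EV N × EV N) ≃ₗ[ℝ] (EV N × EV N))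
    (D : Set (EV N × EV N))
    (hD : D = Set.range (fun m : (Fin N → ℤ) × (Fin N → ℤ) => A (intPoint m)))
    (f g k : SchwartzMap (EV N) ℂ) :
    Summable (fun h : D =>
      innerL2 f (tfShift (h : EV N × EV N).1 (h : EV N × EV N).2 g) *
        innerL2 (tfShift (h : EV N × EV N).1 (h : EV N × EV N).2 g) k) ∧
    Summable (fun z : adjointLattice D =>
      innerL2 g (tfShift (z : EV N × EV N).1 (z : EV N × EV N).2 g) *
        innerL2 (tfShift (z : EV N × EV N).1 (z : EV N × EV N).2 f) k) ∧
    ∑' h : D, innerL2 f (tfShift (h : EV N × EV N).1 (h : EV N × EV N).2 g) *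
        innerL2 (tfShift (h : EV N × EV N).1 (h : EV N × EV N).2 g) k
      = (((|LinearMap.det (A : (EV N × EV N) →ₗ[ℝ] (EV N × EV N))|)⁻¹ : ℝ) : ℂ) *
          ∑' z : adjointLattice D,
            innerL2 g (tfShift (z : EV N × EV N).1 (z : EV N × EV N).2 g) *
              innerL2 (tfShift (z : EV N × EV N).1 (z : EV N × EV N).2 f) k := by

  have hM : Fintype.card (Fin N ⊕ Fin N) < 2 * N + 1 := by
    simp only [Fintype.card_sum, Fintype.card_fin]
    lia
  rw [range_intPoint] at hD
  have hD' : adjointLattice D = _ := hD ▸ adjointLattice_range (sumParam A)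
  have hA : Function.Injective fun m : Fin N ⊕ Fin N → ℤ => sumParam A fun i => (m i : ℝ) :=
    (sumParam A).injective.comp injective_intCast_comp
  have hW : Function.Injective
      fun n : Fin N ⊕ Fin N → ℤ => sympDual (sumParam A) fun i => (n i : ℝ) :=
    (sympDual_injective _).comp injective_intCast_comp
  set F : EV N × EV N → ℂ := fun z =>
    innerL2 f (tfShift z.1 z.2 g) * innerL2 (tfShift z.1 z.2 g) k with hF
  set G : EV N × EV N → ℂ := fun z =>
    innerL2 g (tfShift z.1 z.2 g) * innerL2 (tfShift z.1 z.2 f) k with hG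
  set c : ℂ := (((|LinearMap.det (A : (EV N × EV N) →ₗ[ℝ] (EV N × EV N))|)⁻¹ : ℝ) : ℂ)
  have hFd : PolyDecay (2 * N + 1) fun s => F (sumParam A s) :=
    (polyDecay_innerL2_mul f g g k _).comp_linear (sumParam A).toLinearMap (sumParam A).injective
  have hFc : Continuous fun s => F (sumParam A s) :=
    (continuous_innerL2_mul f g g k).comp (sumParam A).toContinuousLinearEquiv.continuous
  have hGs : Summable fun n : Fin N ⊕ Fin N → ℤ => G (sympDual (sumParam A) fun i => (n i : ℝ)) :=
    ((polyDecay_innerL2_mul g g f k _).comp_linear _ (sympDual_injective _)).summable_int hM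
  have hfour : ∀ n : Fin N ⊕ Fin N → ℤ,
      ∫ s : Fin N ⊕ Fin N → ℝ, expi (-∑ i, (n i : ℝ) * s i) * F (sumParam A s) =
        c * G (sympDual (sumParam A) fun i => (n i : ℝ)) := fun n => by
    set w := sympDual (sumParam A) fun i => (n i : ℝ) with hw
    have h := integral_expi_mul_innerL2_mul f g k w.1 (-w.2)
    rw [neg_neg] at h
    simp only [hG]
    rw [← h, ← integral_comp_sumParam]
    refine integral_congr_ae (Filter.Eventually.of_forall fun s => ?_)
    simp only
    rw [← sympForm_sympDual (sumParam A) s fun i => (n i : ℝ), ← hw, sympForm, dotR_neg_right,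
      sub_eq_neg_add]
  refine ⟨(summable_subtype_range_iff hA hD F).2 (hFd.summable_int hM),
    (summable_subtype_range_iff hW hD' G).2 hGs, ?_⟩
  refine (tsum_subtype_range hA hD F).trans ?_
  refine Eq.trans ?_ (congrArg (c * ·) (tsum_subtype_range hW hD' G)).symm
  have hP := poisson_summation hM hFd hFc (by simpa only [hfour] using hGs.mul_left c)
  simp only [hfour, tsum_mul_left] at hP
  exact hP
end
end

section
/- Let T be a complex symmetric N×N matrix with Re T positive definite, and g_T(x) = e^{−⟨Tx,x⟩} the associated generalized Gaussian on ℝᴺ. Let D ⊂ ℝ²ᴺ be a full-rank lattice. Then for every s ≥ 0, the sequence of Gabor coefficients (⟨g_T, π(h) g_T⟩)_{h ∈ D} belongs to the weighted space ℓ¹_s(D): ∑_{h ∈ D} |⟨g_T, π(h) g_T⟩| (1 + |h|²)^{s/2} < ∞, where ⟨·,·⟩ is the L²(ℝᴺ) inner product. -/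
open MeasureTheory Complex Real

noncomputable section

/-- The generalized Gaussian `g_T(x) = e^{−⟨Tx,x⟩}`. -/
def gaussT {N : ℕ} (T : Matrix (Fin N) (Fin N) ℂ) : EV N → ℂ :=
  fun x => Complex.exp (-(∑ i, (∑ j, T i j * ((x j : ℝ) : ℂ)) * ((x i : ℝ) : ℂ)))

section

open Matrix

theorem Matrix.PosDef.exists_eq_transpose_mul_self {n : Type*} [Fintype n] [DecidableEq n]
    {R : Matrix n n ℝ} (hR : R.PosDef) : ∃ B : Matrix n n ℝ, B.det ≠ 0 ∧ R = Bᵀ * B := by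
  open scoped MatrixOrder Matrix.Norms.L2Operator in
  obtain ⟨B, hB, h⟩ := CStarAlgebra.isStrictlyPositive_iff_eq_star_mul_self.mp
    hR.isStrictlyPositive
  refine ⟨B, ((isUnit_iff_isUnit_det B).mp hB).ne_zero, ?_⟩
  rw [h, star_eq_conjTranspose, conjTranspose_eq_transpose_of_trivial]

theorem integral_comp_mulVec {n : Type*} [Fintype n] [DecidableEq n] {B : Matrix n n ℝ}
    (hB : B.det ≠ 0) (F : (n → ℝ) → ℂ) :
    ∫ t, F (B *ᵥ t) = ((|B.det⁻¹| : ℝ) : ℂ) * ∫ u, F u := by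
  have hemb : MeasurableEmbedding (toLin' B) :=
    ((toLin' B).equivOfDetNeZero (by simpa using hB)).toContinuousLinearEquiv.toHomeomorph
      |>.measurableEmbedding
  have h := hemb.integral_map (μ := MeasureTheory.volume) F
  rw [Real.map_matrix_volume_pi_eq_smul_volume_pi hB, integral_smul_measure] at h
  simpa using h.symm

theorem sum_mulVec_mul_eq {n : Type*} [Fintype n] (S : Matrix n n ℝ) (t : n → ℝ) :
    ∑ i, (∑ j, S i j * t j) * t i = t ⬝ᵥ S *ᵥ t := by
  simp [dotProduct, mulVec, mul_comm]

theorem gaussT_eq {N : ℕ} (T : Matrix (Fin N) (Fin N) ℂ) (t : EV N) :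
    gaussT T t = Complex.exp (-(((t ⬝ᵥ T.map Complex.re *ᵥ t : ℝ) : ℂ) +
      Complex.I * ((t ⬝ᵥ T.map Complex.im *ᵥ t : ℝ) : ℂ))) := by
  rw [gaussT, ← sum_mulVec_mul_eq, ← sum_mulVec_mul_eq]
  congr 2
  push_cast
  rw [Finset.mul_sum, ← Finset.sum_add_distrib]
  refine Finset.sum_congr rfl fun i _ => ?_
  rw [← mul_assoc, ← add_mul, Finset.mul_sum, ← Finset.sum_add_distrib]
  congr 1
  refine Finset.sum_congr rfl fun j _ => ?_
  conv_lhs => rw [← Complex.re_add_im (T i j)]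
  simp only [Matrix.map_apply]
  ring

theorem norm_integral_gaussian {N : ℕ} (a v : EV N) :
    ‖∫ u : EV N, Complex.exp (-(2 : ℂ) * ∑ i, (u i : ℂ) ^ 2 +
        ∑ i, (2 * (a i : ℂ) - Complex.I * (v i : ℂ)) * u i)‖ =
      ‖(π / 2 : ℂ) ^ (N / 2 : ℂ)‖ * Real.exp ((4 * (a ⬝ᵥ a) - v ⬝ᵥ v) / 8) := by
  rw [GaussianFourier.integral_cexp_neg_mul_sum_add (by norm_num), norm_mul, Fintype.card_fin,
    Complex.norm_exp]
  congr 2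
  have h : (∑ i, (2 * (a i : ℂ) - Complex.I * (v i : ℂ)) ^ 2) / (4 * 2) =
      (((4 * (a ⬝ᵥ a) - v ⬝ᵥ v) / 8 : ℝ) : ℂ) -
        ((∑ i, a i * v i / 2 : ℝ) : ℂ) * Complex.I := by
    simp only [dotProduct]
    push_cast
    rw [Finset.mul_sum, ← Finset.sum_sub_distrib, Finset.sum_div, Finset.sum_div,
      Finset.sum_mul, ← Finset.sum_sub_distrib]
    refine Finset.sum_congr rfl fun i _ => ?_
    linear_combination ((v i : ℂ) ^ 2 / 8) * Complex.I_sq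
  rw [h]
  simp

theorem gaussT_mul_conj_tfShift {N : ℕ} {T : Matrix (Fin N) (Fin N) ℂ} (hT : T.IsSymm)
    {B : Matrix (Fin N) (Fin N) ℝ} (hR : T.map Complex.re = Bᵀ * B) {x ω v : EV N}
    (hv : Bᵀ *ᵥ v = (2 : ℝ) • (T.map Complex.im *ᵥ x) + (2 * π) • ω) (t : EV N) :
    gaussT T t * (starRingEnd ℂ) (tfShift x ω (gaussT T) t) =
      Complex.exp (-((B *ᵥ x ⬝ᵥ B *ᵥ x : ℝ) : ℂ) +
          ((x ⬝ᵥ T.map Complex.im *ᵥ x : ℝ) : ℂ) * Complex.I) *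
        Complex.exp (-(2 : ℂ) * ∑ i, ((B *ᵥ t) i : ℂ) ^ 2 +
          ∑ i, (2 * ((B *ᵥ x) i : ℂ) - Complex.I * (v i : ℂ)) * (B *ᵥ t) i) := by
  have hq : ∀ y : EV N, y ⬝ᵥ T.map Complex.re *ᵥ y = B *ᵥ y ⬝ᵥ B *ᵥ y := fun y => by
    rw [hR, ← mulVec_mulVec, dotProduct_mulVec, vecMul_transpose]
  have hMsymm : (T.map Complex.im)ᵀ = T.map Complex.im := by
    rw [← transpose_map, hT.eq]
  have hM : x ⬝ᵥ T.map Complex.im *ᵥ t = t ⬝ᵥ T.map Complex.im *ᵥ x := by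
    rw [dotProduct_mulVec, ← mulVec_transpose, hMsymm, dotProduct_comm]
  have hd : dotR t ω = t ⬝ᵥ ω := rfl
  have hlin : B *ᵥ t ⬝ᵥ v = 2 * (t ⬝ᵥ T.map Complex.im *ᵥ x) + 2 * π * (t ⬝ᵥ ω) := by
    rw [← vecMul_transpose, ← dotProduct_mulVec, hv, dotProduct_add, dotProduct_smul,
      dotProduct_smul, smul_eq_mul, smul_eq_mul]
  have hsq : ∑ i, ((B *ᵥ t) i : ℂ) ^ 2 = ((B *ᵥ t ⬝ᵥ B *ᵥ t : ℝ) : ℂ) := by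
    simp only [dotProduct]
    push_cast
    simp only [sq]
  have hsum : ∑ i, (2 * ((B *ᵥ x) i : ℂ) - Complex.I * (v i : ℂ)) * (B *ᵥ t) i =
      2 * ((B *ᵥ t ⬝ᵥ B *ᵥ x : ℝ) : ℂ) - Complex.I * ((B *ᵥ t ⬝ᵥ v : ℝ) : ℂ) := by
    simp only [dotProduct]
    push_cast
    rw [Finset.mul_sum, Finset.mul_sum, ← Finset.sum_sub_distrib]
    exact Finset.sum_congr rfl fun i _ => by ring
  have hx : B *ᵥ x ⬝ᵥ B *ᵥ t = B *ᵥ t ⬝ᵥ B *ᵥ x := dotProduct_comm _ _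
  rw [tfShift, gaussT_eq, gaussT_eq, map_mul, ← Complex.exp_conj, ← Complex.exp_conj,
    ← Complex.exp_add, ← Complex.exp_add, ← Complex.exp_add, hq, hq, hsq, hsum, hlin, hd]
  congr 1
  simp only [mulVec_sub, dotProduct_sub, sub_dotProduct, hM, hx, map_neg, map_add, map_mul,
    Complex.conj_I, Complex.conj_ofReal, map_ofNat]
  push_cast
  ring

/-- The modulus of the ambiguity function of a generalized Gaussian is itself Gaussian. -/
theorem norm_innerL2_gaussT {N : ℕ} {T : Matrix (Fin N) (Fin N) ℂ} (hT : T.IsSymm)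
    {B : Matrix (Fin N) (Fin N) ℝ} (hB : B.det ≠ 0) (hR : T.map Complex.re = Bᵀ * B)
    {x ω v : EV N} (hv : Bᵀ *ᵥ v = (2 : ℝ) • (T.map Complex.im *ᵥ x) + (2 * π) • ω) :
    ‖innerL2 (gaussT T) (tfShift x ω (gaussT T))‖ =
      |B.det⁻¹| * ‖(π / 2 : ℂ) ^ (N / 2 : ℂ)‖ *
        Real.exp (-(4 * (B *ᵥ x ⬝ᵥ B *ᵥ x) + v ⬝ᵥ v) / 8) := by
  simp only [innerL2, gaussT_mul_conj_tfShift hT hR hv]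
  rw [integral_const_mul, integral_comp_mulVec hB (fun u => Complex.exp (-(2 : ℂ) *
    ∑ i, (u i : ℂ) ^ 2 + ∑ i, (2 * ((B *ᵥ x) i : ℂ) - Complex.I * (v i : ℂ)) * u i)),
    norm_mul, norm_mul, norm_integral_gaussian, Complex.norm_exp, Complex.norm_real]
  have h : -(4 * (B *ᵥ x ⬝ᵥ B *ᵥ x) + v ⬝ᵥ v) / 8 =
      -(B *ᵥ x ⬝ᵥ B *ᵥ x) + (4 * (B *ᵥ x ⬝ᵥ B *ᵥ x) - v ⬝ᵥ v) / 8 := by ring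
  rw [h, Real.exp_add, Real.norm_eq_abs, abs_abs]
  simp
  ring


theorem sq_norm_le_dotProduct_self {n : Type*} [Fintype n] (a : n → ℝ) :
    ‖a‖ ^ 2 ≤ a ⬝ᵥ a := by
  have h0 : 0 ≤ a ⬝ᵥ a := Finset.sum_nonneg fun i _ => mul_self_nonneg (a i)
  refine (Real.le_sqrt (norm_nonneg _) h0).mp
    ((pi_norm_le_iff_of_nonneg (Real.sqrt_nonneg _)).mpr fun i => ?_)
  refine Real.abs_le_sqrt ?_
  rw [sq]
  exact Finset.single_le_sum (f := fun i => a i * a i) (fun i _ => mul_self_nonneg (a i))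
    (Finset.mem_univ i)

theorem dotProduct_self_le_card_mul_sq_norm {n : Type*} [Fintype n] (a : n → ℝ) :
    a ⬝ᵥ a ≤ Fintype.card n * ‖a‖ ^ 2 := by
  rw [← nsmul_eq_mul]
  refine Finset.sum_le_card_nsmul _ _ _ fun i _ => ?_
  rw [← sq, ← sq_abs]
  exact pow_le_pow_left₀ (abs_nonneg _) (norm_le_pi_norm a i) 2

theorem exists_rpow_mul_exp_neg_mul_le (p : ℝ) {c : ℝ} (hc : 0 < c) :
    ∃ C : ℝ, ∀ y : ℝ, 1 ≤ y → y ^ p * Real.exp (-(c * y)) ≤ C := by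
  refine ⟨(⌈p⌉₊.factorial : ℝ) / c ^ ⌈p⌉₊, fun y hy => ?_⟩
  have hy0 : 0 < y := by linarith
  have h1 : y ^ p ≤ y ^ ⌈p⌉₊ := by
    rw [← Real.rpow_natCast]
    exact Real.rpow_le_rpow_of_exponent_le hy (Nat.le_ceil p)
  have h2 := Real.pow_div_factorial_le_exp _ (mul_pos hc hy0).le ⌈p⌉₊
  rw [div_le_iff₀ (by positivity), mul_pow] at h2
  rw [Real.exp_neg, ← div_eq_mul_inv, div_le_div_iff₀ (Real.exp_pos _) (by positivity)]
  nlinarith [mul_le_mul_of_nonneg_right h1 (pow_nonneg hc.le ⌈p⌉₊)]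

theorem exists_norm_sq_le_dotProduct {N : ℕ} {B : Matrix (Fin N) (Fin N) ℝ} (hB : B.det ≠ 0)
    (M : Matrix (Fin N) (Fin N) ℝ) :
    ∃ K : ℝ, 0 ≤ K ∧ ∀ h : EV N × EV N, ∃ v : EV N,
      Bᵀ *ᵥ v = (2 : ℝ) • (M *ᵥ h.1) + (2 * π) • h.2 ∧
      ‖h‖ ^ 2 ≤ K * (B *ᵥ h.1 ⬝ᵥ B *ᵥ h.1 + v ⬝ᵥ v) := by
  have hBu : IsUnit B.det := isUnit_iff_ne_zero.mpr hB
  have hBt : IsUnit Bᵀ.det := by rwa [det_transpose]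
  let L : (EV N × EV N) →ₗ[ℝ] (EV N × EV N) :=
    (B.mulVecLin ∘ₗ LinearMap.fst ℝ _ _).prod
      ((Bᵀ)⁻¹.mulVecLin ∘ₗ ((2 : ℝ) • (M.mulVecLin ∘ₗ LinearMap.fst ℝ _ _) +
        (2 * π) • LinearMap.snd ℝ _ _))
  have hL1 : ∀ h, (L h).1 = B *ᵥ h.1 := fun _ => rfl
  have hL2 : ∀ h, (L h).2 = (Bᵀ)⁻¹ *ᵥ ((2 : ℝ) • (M *ᵥ h.1) + (2 * π) • h.2) := fun _ => rfl
  have hv : ∀ h, Bᵀ *ᵥ (L h).2 = (2 : ℝ) • (M *ᵥ h.1) + (2 * π) • h.2 := fun h => by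
    rw [hL2, mulVec_mulVec, mul_nonsing_inv _ hBt, one_mulVec]
  have hker : LinearMap.ker L = ⊥ := by
    refine LinearMap.ker_eq_bot'.mpr fun h hh => ?_
    have h1 : h.1 = 0 := by
      have := hL1 h
      rw [hh] at this
      exact eq_zero_of_mulVec_eq_zero hB this.symm
    have h2 : h.2 = 0 := by
      have := hv h
      rw [hh, h1] at this
      simpa [Real.pi_ne_zero] using this.symm
    exact Prod.ext h1 h2
  obtain ⟨K, -, hK⟩ := L.exists_antilipschitzWith hker
  refine ⟨(K : ℝ) ^ 2, by positivity, fun h => ⟨(L h).2, hv h, ?_⟩⟩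
  have h1 : ‖h‖ ≤ K * ‖L h‖ := by simpa using hK.le_mul_dist h 0
  have h2 : ‖L h‖ ^ 2 ≤ (L h).1 ⬝ᵥ (L h).1 + (L h).2 ⬝ᵥ (L h).2 := by
    have ha := sq_norm_le_dotProduct_self (L h).1
    have hb := sq_norm_le_dotProduct_self (L h).2
    rcases max_choice ‖(L h).1‖ ‖(L h).2‖ with hm | hm <;> rw [Prod.norm_def, hm] <;>
      nlinarith [sq_nonneg ‖(L h).1‖, sq_nonneg ‖(L h).2‖]
  calc ‖h‖ ^ 2 ≤ (K * ‖L h‖) ^ 2 := by gcongr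
    _ = (K : ℝ) ^ 2 * ‖L h‖ ^ 2 := mul_pow _ _ _
    _ ≤ _ := by gcongr; exact h2

theorem exists_gabor_coefficient_mul_norm_pow_le {N : ℕ} {T : Matrix (Fin N) (Fin N) ℂ}
    (hT : T.IsSymm) (hRe : (T.map Complex.re).PosDef) {s : ℝ} (hs : 0 ≤ s) (n : ℕ) :
    ∃ C : ℝ, ∀ h : EV N × EV N,
      ‖innerL2 (gaussT T) (tfShift h.1 h.2 (gaussT T))‖ *
        (1 + dotR h.1 h.1 + dotR h.2 h.2) ^ (s / 2) * (‖h‖ ^ 2) ^ n ≤ C := by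
  obtain ⟨B, hB, hR⟩ := hRe.exists_eq_transpose_mul_self
  obtain ⟨K, hK0, hK⟩ := exists_norm_sq_le_dotProduct hB (T.map Complex.im)
  obtain ⟨C, hC⟩ := exists_rpow_mul_exp_neg_mul_le (s / 2 + n) (c := 1 / 8) (by norm_num)
  refine ⟨|B.det⁻¹| * ‖(π / 2 : ℂ) ^ (N / 2 : ℂ)‖ * Real.exp (1 / 8) *
    (1 + 2 * N * K) ^ (s / 2) * K ^ n * C, fun h => ?_⟩
  obtain ⟨v, hv, hle⟩ := hK h
  rw [norm_innerL2_gaussT hT hB hR hv]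
  have ha := (sq_nonneg _).trans (sq_norm_le_dotProduct_self (B *ᵥ h.1))
  have hvv := (sq_nonneg _).trans (sq_norm_le_dotProduct_self v)
  set y : ℝ := 1 + (B *ᵥ h.1 ⬝ᵥ B *ᵥ h.1 + v ⬝ᵥ v) with hy
  have hy1 : 1 ≤ y := by linarith
  have hy0 : 0 < y := by linarith
  have hnorm : ‖h‖ ^ 2 ≤ K * y := hle.trans (by gcongr; linarith)
  have hexp : Real.exp (-(4 * (B *ᵥ h.1 ⬝ᵥ B *ᵥ h.1) + v ⬝ᵥ v) / 8) ≤
      Real.exp (1 / 8) * Real.exp (-(1 / 8 * y)) := by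
    rw [← Real.exp_add]
    exact Real.exp_le_exp.mpr (by linarith)
  have h1 : dotR h.1 h.1 ≤ N * ‖h‖ ^ 2 := by
    refine (dotProduct_self_le_card_mul_sq_norm h.1).trans ?_
    rw [Fintype.card_fin]
    gcongr
    exact norm_fst_le h
  have h2 : dotR h.2 h.2 ≤ N * ‖h‖ ^ 2 := by
    refine (dotProduct_self_le_card_mul_sq_norm h.2).trans ?_
    rw [Fintype.card_fin]
    gcongr
    exact norm_snd_le h
  have h10 : 0 ≤ dotR h.1 h.1 := (sq_nonneg _).trans (sq_norm_le_dotProduct_self h.1)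
  have h20 : 0 ≤ dotR h.2 h.2 := (sq_nonneg _).trans (sq_norm_le_dotProduct_self h.2)
  have hW : 1 + dotR h.1 h.1 + dotR h.2 h.2 ≤ (1 + 2 * N * K) * y := by
    have : (N : ℝ) * ‖h‖ ^ 2 ≤ N * (K * y) := by gcongr
    linarith
  calc _ ≤ |B.det⁻¹| * ‖(π / 2 : ℂ) ^ (N / 2 : ℂ)‖ *
        (Real.exp (1 / 8) * Real.exp (-(1 / 8 * y))) *
        ((1 + 2 * N * K) * y) ^ (s / 2) * (K * y) ^ n := by gcongr
    _ = |B.det⁻¹| * ‖(π / 2 : ℂ) ^ (N / 2 : ℂ)‖ * Real.exp (1 / 8) *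
        (1 + 2 * N * K) ^ (s / 2) * K ^ n *
        (y ^ (s / 2 + n) * Real.exp (-(1 / 8 * y))) := by
      rw [Real.mul_rpow (by positivity) hy0.le, Real.rpow_add hy0, Real.rpow_natCast, mul_pow]
      ring
    _ ≤ _ := by
      gcongr
      exact hC y hy1

theorem range_intPoint_eq_span {N : ℕ} (A : (EV N × EV N) ≃ₗ[ℝ] (EV N × EV N)) :
    Set.range (fun m : (Fin N → ℤ) × (Fin N → ℤ) => A (intPoint m)) =
      Submodule.span ℤ (Set.range
        (((Pi.basisFun ℝ (Fin N)).prod (Pi.basisFun ℝ (Fin N))).map A)) := by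
  ext h
  rw [SetLike.mem_coe, Module.Basis.mem_span_iff_repr_mem]
  simp only [Module.Basis.map_repr, LinearEquiv.trans_apply, Sum.forall,
    Module.Basis.prod_repr_inl, Module.Basis.prod_repr_inr, Pi.basisFun_repr, Set.mem_range]
  constructor
  · rintro ⟨m, rfl⟩
    simp [intPoint]
  · rintro ⟨h1, h2⟩
    choose m₁ hm₁ using h1
    choose m₂ hm₂ using h2
    refine ⟨(m₁, m₂), ?_⟩
    rw [← LinearEquiv.eq_symm_apply]
    exact Prod.ext (funext hm₁) (funext hm₂)

theorem ZLattice.summable_of_mul_norm_pow_le {E : Type*} [NormedAddCommGroup E] [NormedSpace ℝ E]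
    [FiniteDimensional ℝ E] (L : Submodule ℤ E) [DiscreteTopology L] {f : E → ℝ}
    (hf : ∀ h, 0 ≤ f h) (hbound : ∀ n : ℕ, ∃ C : ℝ, ∀ h, f h * (‖h‖ ^ 2) ^ n ≤ C) :
    Summable fun h : L => f h := by
  obtain ⟨C, hC⟩ := hbound (Module.finrank ℤ L + 1)
  have hsum :=
    (ZLattice.summable_norm_pow_inv L (2 * (Module.finrank ℤ L + 1)) (by omega)).mul_left C
  refine hsum.of_norm_bounded_eventually ?_
  filter_upwards [(Set.finite_singleton (0 : L)).compl_mem_cofinite] with h hh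
  have hpos : 0 < ‖(h : E)‖ := norm_pos_iff.mpr fun h0 => hh (Subtype.ext h0)
  rw [Real.norm_of_nonneg (hf h), pow_mul, inv_pow, inv_pow, ← div_eq_mul_inv]
  exact (le_div_iff₀ (by positivity)).mpr (hC h)

end

/-- Let `T` be a complex symmetric `N×N` matrix with `Re T` positive definite,
`g_T(x) = e^{−⟨Tx,x⟩}` the associated generalized Gaussian, and `D = Aℤ²ᴺ ⊂ ℝ²ᴺ`
a full-rank lattice.  Then for every `s ≥ 0` the Gabor coefficients
`(⟨g_T, π(h)g_T⟩)_{h ∈ D}` belong to `ℓ¹_s(D)`: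
`∑_{h ∈ D} |⟨g_T, π(h)g_T⟩| (1+|h|²)^{s/2} < ∞`. -/
theorem gauss_gabor_coefficients {N : ℕ}
    (T : Matrix (Fin N) (Fin N) ℂ) (hT : T.IsSymm)
    (hRe : (T.map Complex.re).PosDef)
    (A : (EV N × EV N) ≃ₗ[ℝ] (EV N × EV N))
    (D : Set (EV N × EV N))
    (hD : D = Set.range (fun m : (Fin N → ℤ) × (Fin N → ℤ) => A (intPoint m))) :
    ∀ s : ℝ, 0 ≤ s →
      Summable (fun h : D =>
        ‖innerL2 (gaussT T)
            (tfShift (h : EV N × EV N).1 (h : EV N × EV N).2 (gaussT T))‖ *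
          (1 + dotR (h : EV N × EV N).1 (h : EV N × EV N).1 +
              dotR (h : EV N × EV N).2 (h : EV N × EV N).2) ^ (s / 2)) := by
  intro s hs
  subst hD
  rw [range_intPoint_eq_span A]
  refine ZLattice.summable_of_mul_norm_pow_le (Submodule.span ℤ _) (f := fun h : EV N × EV N =>
    ‖innerL2 (gaussT T) (tfShift h.1 h.2 (gaussT T))‖ *
      (1 + dotR h.1 h.1 + dotR h.2 h.2) ^ (s / 2)) (fun h => ?_)
    (exists_gabor_coefficient_mul_norm_pow_le hT hRe hs)
  have h1 : 0 ≤ dotR h.1 h.1 := Finset.sum_nonneg fun i _ => mul_self_nonneg _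
  have h2 : 0 ≤ dotR h.2 h.2 := Finset.sum_nonneg fun i _ => mul_self_nonneg _
  positivity
end
end

section
/- (Irreducibility of the Schrödinger representation.) Let V ⊆ L²(ℝᴺ) be a closed subspace that is invariant under all time–frequency shifts, i.e. π(x,ω)V ⊆ V for every (x,ω) ∈ ℝᴺ × ℝᴺ. Then V = {0} or V = L²(ℝᴺ). -/
open MeasureTheory Complex Real

noncomputable section

/-- An integrable real function with vanishing characteristic function vanishes almost everywhere. -/
theorem ae_eq_zero_of_forall_integral_exp_mul_ofReal_eq_zero {E : Type*} [NormedAddCommGroup E]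
    [NormedSpace ℝ E] [CompleteSpace E] [SecondCountableTopology E] [MeasurableSpace E]
    [BorelSpace E] {μ : Measure E} {g : E → ℝ} (hg : Integrable g μ)
    (h : ∀ L : StrongDual ℝ E, ∫ v, Complex.exp (L v * Complex.I) * (g v : ℂ) ∂μ = 0) :
    g =ᵐ[μ] 0 := by
  have fin (k : E → ℝ) (hk : Integrable k μ) :
      IsFiniteMeasure (μ.withDensity fun v => ENNReal.ofReal (k v)) :=
    isFiniteMeasure_withDensity_ofReal hk.2
  have cf (k : E → ℝ) (hk : Integrable k μ) (L : StrongDual ℝ E) :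
      charFunDual (μ.withDensity fun v => ENNReal.ofReal (k v)) L =
        ∫ v, Complex.exp (L v * Complex.I) * ((max (k v) 0 : ℝ) : ℂ) ∂μ := by
    rw [charFunDual_apply, integral_withDensity_eq_integral_toReal_smul₀
      hk.aemeasurable.ennreal_ofReal (by simp)]
    simp [ENNReal.toReal_ofReal', mul_comm]
  have int (k : E → ℝ) (hk : Integrable k μ) (L : StrongDual ℝ E) :
      Integrable (fun v => Complex.exp (L v * Complex.I) * ((max (k v) 0 : ℝ) : ℂ)) μ := by
    refine hk.pos_part.ofReal.bdd_mul (c := 1) ?_ ?_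
    · exact Continuous.aestronglyMeasurable (by fun_prop)
    · simp [Complex.norm_exp_ofReal_mul_I]
  have hgn : Integrable (fun v => -g v) μ := hg.neg
  have := fin g hg
  have := fin _ hgn
  have heq : μ.withDensity (fun v => ENNReal.ofReal (g v)) =
      μ.withDensity fun v => ENNReal.ofReal (-g v) := by
    refine Measure.ext_of_charFunDual <| funext fun L => ?_
    rw [cf g hg, cf _ hgn, ← sub_eq_zero, ← integral_sub (int g hg L) (int _ hgn L), ← h L]
    refine integral_congr_ae (.of_forall fun v => ?_)
    simp only [← mul_sub, ← Complex.ofReal_sub]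
    simp only [max_zero_sub_max_neg_zero_eq_self]
  rw [withDensity_eq_iff hg.aemeasurable.ennreal_ofReal hgn.aemeasurable.ennreal_ofReal
    (hg.lintegral_lt_top).ne] at heq
  filter_upwards [heq] with v hv
  have := congrArg ENNReal.toReal hv
  simp only [ENNReal.toReal_ofReal'] at this
  rw [← max_zero_sub_max_neg_zero_eq_self (g v), this, sub_self, Pi.zero_apply]

/-- An integrable complex function with vanishing Fourier transform vanishes almost everywhere. -/
theorem ae_eq_zero_of_forall_integral_exp_mul_eq_zero {E : Type*} [NormedAddCommGroup E]
    [NormedSpace ℝ E] [CompleteSpace E] [SecondCountableTopology E] [MeasurableSpace E]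
    [BorelSpace E] {μ : Measure E} {g : E → ℂ} (hg : Integrable g μ)
    (h : ∀ L : StrongDual ℝ E, ∫ v, Complex.exp (L v * Complex.I) * g v ∂μ = 0) :
    g =ᵐ[μ] 0 := by
  have int (k : E → ℂ) (hk : Integrable k μ) (L : StrongDual ℝ E) :
      Integrable (fun v => Complex.exp (L v * Complex.I) * k v) μ := by
    refine hk.bdd_mul (c := 1) ?_ ?_
    · exact Continuous.aestronglyMeasurable (by fun_prop)
    · simp [Complex.norm_exp_ofReal_mul_I]
  have hgc : Integrable (fun v => (starRingEnd ℂ) (g v)) μ :=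
    (Complex.conjCLE : ℂ →L[ℝ] ℂ).integrable_comp hg
  have hc (L : StrongDual ℝ E) :
      ∫ v, Complex.exp (L v * Complex.I) * (starRingEnd ℂ) (g v) ∂μ = 0 := by
    rw [← map_zero (starRingEnd ℂ), ← h (-L), ← integral_conj]
    refine integral_congr_ae (.of_forall fun v => ?_)
    simp [← Complex.exp_conj]
  have hre : (fun v => (g v).re) =ᵐ[μ] 0 := by
    refine ae_eq_zero_of_forall_integral_exp_mul_ofReal_eq_zero hg.re fun L => ?_
    calc _ = ∫ v, (1 / 2 : ℂ) * (Complex.exp (L v * Complex.I) * g v +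
          Complex.exp (L v * Complex.I) * (starRingEnd ℂ) (g v)) ∂μ := by
          refine integral_congr_ae (.of_forall fun v => ?_)
          simp only [Complex.re_eq_add_conj]
          ring
      _ = 0 := by
          rw [integral_const_mul, integral_add (int g hg L) (int _ hgc L), h, hc]; simp
  have him : (fun v => (g v).im) =ᵐ[μ] 0 := by
    refine ae_eq_zero_of_forall_integral_exp_mul_ofReal_eq_zero hg.im fun L => ?_
    calc _ = ∫ v, (1 / (2 * Complex.I) : ℂ) * (Complex.exp (L v * Complex.I) * g v -
          Complex.exp (L v * Complex.I) * (starRingEnd ℂ) (g v)) ∂μ := by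
          refine integral_congr_ae (.of_forall fun v => ?_)
          simp only [Complex.im_eq_sub_conj]
          ring
      _ = 0 := by
          rw [integral_const_mul, integral_sub (int g hg L) (int _ hgc L), h, hc]; simp
  filter_upwards [hre, him] with v h1 h2
  exact Complex.ext h1 h2

/-- Every continuous functional on `ℝᴺ` is `2π` times the dot product with some vector. -/
theorem exists_dotR_eq {N : ℕ} (L : StrongDual ℝ (EV N)) :
    ∃ ω : EV N, ∀ t, L t = 2 * π * dotR t ω := by
  refine ⟨fun i => L (Pi.single i 1) / (2 * π), fun t => ?_⟩
  conv_lhs => rw [pi_eq_sum_univ' t, map_sum]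
  rw [dotR, Finset.mul_sum]
  refine Finset.sum_congr rfl fun i _ => ?_
  rw [map_smul, smul_eq_mul]
  field_simp

/-- If almost every `t` annihilates `h t * f (t - x)`, for every `x`, then `h` or `f` vanishes. -/
theorem ae_eq_zero_or_of_forall_mul_translate_ae_eq_zero {G : Type*} [AddCommGroup G]
    [MeasurableSpace G] [MeasurableAdd₂ G] [MeasurableNeg G] {μ : Measure G} [SFinite μ]
    [μ.IsAddLeftInvariant] [μ.IsNegInvariant] {h f : G → ℂ} (hh : Measurable h) (hf : Measurable f)
    (H : ∀ x, ∀ᵐ t ∂μ, h t * f (t - x) = 0) : h =ᵐ[μ] 0 ∨ f =ᵐ[μ] 0 := by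
  have key : (∫⁻ t, ‖h t‖ₑ ∂μ) * ∫⁻ x, ‖f x‖ₑ ∂μ = 0 := by
    calc (∫⁻ t, ‖h t‖ₑ ∂μ) * ∫⁻ x, ‖f x‖ₑ ∂μ
        = ∫⁻ t, ∫⁻ x, ‖h t‖ₑ * ‖f (t - x)‖ₑ ∂μ ∂μ := by
          rw [← lintegral_mul_const _ hh.enorm]
          refine lintegral_congr fun t => ?_
          rw [lintegral_const_mul _ (by fun_prop),
            lintegral_sub_left_eq_self (fun x => ‖f x‖ₑ) t]
      _ = ∫⁻ x, ∫⁻ t, ‖h t‖ₑ * ‖f (t - x)‖ₑ ∂μ ∂μ :=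
          lintegral_lintegral_swap (by fun_prop)
      _ = 0 := by
          refine (lintegral_congr fun x => ?_).trans lintegral_zero
          refine (lintegral_congr_ae ?_).trans lintegral_zero
          filter_upwards [H x] with t ht
          rw [← enorm_mul, ht, enorm_zero]
  rcases mul_eq_zero.1 key with h0 | h0
  · left
    filter_upwards [(lintegral_eq_zero_iff hh.enorm).1 h0] with t ht
    simpa using ht
  · right
    filter_upwards [(lintegral_eq_zero_iff hf.enorm).1 h0] with t ht
    simpa using ht

/-- Irreducibility of the Schrödinger representation: a closed subspace
`V ⊆ L²(ℝᴺ)` invariant under all time–frequency shifts `π(x,ω)` is `{0}` or all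
of `L²(ℝᴺ)`. -/
theorem schroedinger_irreducible {N : ℕ}
    (V : Submodule ℂ (Lp ℂ 2 (volume : Measure (EV N))))
    (hclosed : IsClosed (V : Set (Lp ℂ 2 (volume : Measure (EV N)))))
    (hinv : ∀ (x ω : EV N), ∀ f ∈ V, ∃ g ∈ V,
      (g : EV N → ℂ) =ᵐ[(volume : Measure (EV N))] tfShift x ω (f : EV N → ℂ)) :
    V = ⊥ ∨ V = ⊤ := by
  have : CompleteSpace V := hclosed.completeSpace_coe
  by_contra! hV
  obtain ⟨f, hfV, hf0⟩ := V.ne_bot_iff.1 hV.1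
  obtain ⟨h, hhV, hh0⟩ := Vᗮ.ne_bot_iff.1 (mt Submodule.orthogonal_eq_bot_iff.1 hV.2)
  have hmul (x : EV N) : ∀ᵐ t : EV N, (starRingEnd ℂ) (h t) * f (t - x) = 0 := by
    have hint : Integrable (fun t : EV N => (starRingEnd ℂ) (h t) * f (t - x)) :=
      (Lp.memLp h).star.integrable_mul
        ((Lp.memLp f).comp_measurePreserving (measurePreserving_sub_right volume x))
    refine ae_eq_zero_of_forall_integral_exp_mul_eq_zero hint fun L => ?_
    obtain ⟨ω, hω⟩ := exists_dotR_eq L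
    obtain ⟨g, hgV, hg⟩ := hinv x ω f hfV
    have hin := Submodule.inner_left_of_mem_orthogonal hgV hhV
    rw [L2.inner_def] at hin
    rw [← hin]
    refine integral_congr_ae ?_
    filter_upwards [hg] with t ht
    rw [RCLike.inner_apply, ht, tfShift, hω]
    push_cast
    ring_nf
  rcases ae_eq_zero_or_of_forall_mul_translate_ae_eq_zero
    (Complex.continuous_conj.measurable.comp (Lp.stronglyMeasurable h).measurable) (Lp.stronglyMeasurable f).measurable hmul
    with h0 | h0
  · refine hh0 ((Lp.eq_zero_iff_ae_eq_zero).2 ?_)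
    filter_upwards [h0] with t ht
    simpa using ht
  · exact hf0 ((Lp.eq_zero_iff_ae_eq_zero).2 h0)
end
end
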